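/- arXiv:1411.6283 — 2 statements merged into one kernel-verified Lean document; each statement's English description precedes it below -/
import Mathlib

section
/- Let n ≥ 5 and 3 ≤ K ≤ n−2, and let u ∈ {4,…,n}. The lower representative inequality x_u + Σ_{i=1}^{u−1} x_{i,u} ≥ 1 is facet-defining for P_{n,K}. -/
/-- A `K`-partition of `V = {1,…,n}`: a family of `K` nonempty pairwise disjoint
subsets of `V` (clusters) whose union is `V`. -/
structure KPartition (n K : ℕ) where
  parts : Finset (Finset ℕ)
  card_parts : parts.card = K
  parts_nonempty : ∀ C ∈ parts, C.Nonempty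
  parts_disjoint : ∀ C ∈ parts, ∀ D ∈ parts, C ≠ D → Disjoint C D
  parts_cover : parts.sup id = Finset.Icc 1 n

/-- The ambient space: one (symmetric) edge coordinate for each pair of vertices and one
representative coordinate for each vertex (only the coordinates of edges `uv ∈ E` and of
vertices `v ∈ {4,…,n}` are actually used; the remaining ones are affinely determined, so
affine dimensions agree with those in `ℝ^{|E|+n-3}`). -/
abbrev GPoint : Type := (ℕ × ℕ → ℝ) × (ℕ → ℝ)

open Classical in
/-- The characteristic vector of a `K`-partition: edge component `x_{u,v} = 1` iff `u` and `v`
lie in the same cluster; representative component `x_v = 1` (for `v ∈ {4,…,n}`) iff `v` is the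
smallest element of its cluster. -/
noncomputable def charVec (n K : ℕ) (π : KPartition n K) : GPoint :=
  ⟨fun p => if ∃ C ∈ π.parts, p.1 ∈ C ∧ p.2 ∈ C then 1 else 0,
   fun v => if 4 ≤ v ∧ ∃ C ∈ π.parts, v ∈ C ∧ ∀ w ∈ C, v ≤ w then 1 else 0⟩

/-- `P_{n,K}`: the convex hull of the characteristic vectors of all `K`-partitions. -/
noncomputable def PolyP (n K : ℕ) : Set GPoint :=
  convexHull ℝ {x | ∃ π : KPartition n K, x = charVec n K π}

/-- Affine dimension of a set: the rank of the direction of its affine span. -/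
noncomputable def adim (s : Set GPoint) : ℕ :=
  Module.finrank ℝ (affineSpan ℝ s).direction

/-- `f x ≤ b` is a valid inequality for `P_{n,K}` which is facet-defining. -/
def IsFacetLe (n K : ℕ) (f : GPoint → ℝ) (b : ℝ) : Prop :=
  (∀ x ∈ PolyP n K, f x ≤ b) ∧
  adim {x | x ∈ PolyP n K ∧ f x = b} + 1 = adim (PolyP n K)

/-- `f x ≥ b` is a valid inequality for `P_{n,K}` which is facet-defining. -/
def IsFacetGe (n K : ℕ) (f : GPoint → ℝ) (b : ℝ) : Prop :=
  (∀ x ∈ PolyP n K, b ≤ f x) ∧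
  adim {x | x ∈ PolyP n K ∧ f x = b} + 1 = adim (PolyP n K)

/-- Sum of the edge components of `x` over the edges with both endpoints in `A`. -/
noncomputable def edgeSum (A : Finset ℕ) (x : GPoint) : ℝ :=
  ∑ e ∈ A.offDiag.filter (fun e => e.1 < e.2), x.1 e

open Classical in
/-- The contribution of a cluster to the value of a linear functional with edge coefficients `A`
and representative coefficients `B`. -/
noncomputable def clusterWeight (A : ℕ → ℕ → ℝ) (B : ℕ → ℝ) (C : Finset ℕ) : ℝ :=
  (∑ i ∈ C, ∑ j ∈ C, A i j) + ∑ v ∈ C, if ∀ w ∈ C, v ≤ w then B v else 0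

theorem clusterWeight_singleton (A : ℕ → ℕ → ℝ) (B : ℕ → ℝ) (p : ℕ) :
    clusterWeight A B {p} = A p p + B p := by
  simp [clusterWeight]

theorem clusterWeight_pair (A : ℕ → ℕ → ℝ) (B : ℕ → ℝ) {p q : ℕ} (h : p < q) :
    clusterWeight A B {p, q} = A p p + A q q + (A p q + A q p) + B p := by
  simp [clusterWeight, Finset.sum_pair h.ne, h.le, h.not_ge]
  ring

theorem clusterWeight_triple (A : ℕ → ℕ → ℝ) (B : ℕ → ℝ) {p q r : ℕ} (h : p < q) (h' : q < r) :
    clusterWeight A B {p, q, r} = A p p + A q q + A r r + (A p q + A q p) + (A p r + A r p)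
      + (A q r + A r q) + B p := by
  have hp : p ∉ ({q, r} : Finset ℕ) := by simp; omega
  simp [clusterWeight, Finset.sum_insert hp, Finset.sum_pair h'.ne, h.le, h.not_ge, h'.le,
    h'.not_ge, (h.trans h').le, (h.trans h').not_ge]
  ring

/-- The exchange argument: if all pairs of clusters that cover the same at most four vertices,
one of which is `u`, and that satisfy the facet equation have equal weights, and `B` is zero
at `1, 2, 3, u`, then all the coefficients vanish. -/
theorem coefficients_eq_zero {n u : ℕ} (A : ℕ → ℕ → ℝ) (B : ℕ → ℝ) (hu4 : 4 ≤ u) (hun : u ≤ n)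
    (hB : ∀ v, v ≤ 3 → B v = 0) (hBu : B u = 0)
    (H : ∀ C C' D D' : Finset ℕ, C ∪ C' = D ∪ D' → C ∪ C' ⊆ Finset.Icc 1 n →
      (C ∪ C').card ≤ 4 → Disjoint C C' → Disjoint D D' → C'.Nonempty → D'.Nonempty →
      u ∈ C → u ∈ D → (C.filter (· < u)).card ≤ 1 → (D.filter (· < u)).card ≤ 1 →
      clusterWeight A B C + clusterWeight A B C' = clusterWeight A B D + clusterWeight A B D') :
    (∀ i ∈ Finset.Icc 1 n, ∀ j ∈ Finset.Icc 1 n, i < j → A i j + A j i = 0) ∧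
      ∀ v ∈ Finset.Icc 1 n, B v = 0 := by
  have low₁ : ∀ p q, 1 ≤ p → p < q → q < u →
      A p u + A u p = A q u + A u q ∧ A p q + A q p = A q u + A u q + B q := by
    intro p q hp hpq hqu
    have h1 := H {u} {p, q} {p, u} {q} (by ext; simp)
      (by intro x; simp; omega) (by grind) (by simp; omega) (by simp; omega)
      (by simp) (by simp) (by simp) (by simp)
      (by simp [Finset.filter_singleton])
      (by simp [Finset.filter_insert, Finset.filter_singleton, hpq.trans hqu])
    have h2 := H {u} {p, q} {q, u} {p} (by ext; simp; tauto)
      (by intro x; simp; omega) (by grind) (by simp; omega) (by simp; omega)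
      (by simp) (by simp) (by simp) (by simp)
      (by simp [Finset.filter_singleton])
      (by simp [Finset.filter_insert, Finset.filter_singleton, hqu])
    rw [clusterWeight_singleton, clusterWeight_singleton, clusterWeight_pair A B hpq] at h1 h2
    rw [clusterWeight_pair A B (hpq.trans hqu)] at h1
    rw [clusterWeight_pair A B hqu] at h2
    constructor <;> linarith
  have low₂ : ∀ p q r, 1 ≤ p → p < q → q < r → r < u →
      A p q + A q p + A p r + A r p + A q r + A r q = A p q + A q p + A r u + A u r + B r := by
    intro p q r hp hpq hqr hru
    have h1 := H {u} {p, q, r} {r, u} {p, q} (by ext; simp; tauto)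
      (by intro x; simp; omega) (by grind) (by simp; omega) (by simp; omega)
      (by simp) (by simp) (by simp) (by simp)
      (by simp [Finset.filter_singleton])
      (by simp [Finset.filter_insert, Finset.filter_singleton, hru])
    rw [clusterWeight_singleton, clusterWeight_triple A B hpq hqr, clusterWeight_pair A B hpq,
      clusterWeight_pair A B hru] at h1
    linarith
  have mix₁ : ∀ p w, 1 ≤ p → p < u → u < w → w ≤ n →
      A p w + A w p = A p u + A u p + B w ∧ A p w + A w p = A u w + A w u := by
    intro p w hp hpu huw hwn
    have h1 := H {u} {p, w} {p, u} {w} (by ext; simp)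
      (by intro x; simp; omega) (by grind) (by simp; omega) (by simp; omega)
      (by simp) (by simp) (by simp) (by simp)
      (by simp [Finset.filter_singleton])
      (by simp [Finset.filter_insert, Finset.filter_singleton, hpu])
    have h2 := H {u} {p, w} {u, w} {p} (by ext; simp; tauto)
      (by intro x; simp; omega) (by grind) (by simp; omega) (by simp; omega)
      (by simp) (by simp) (by simp) (by simp)
      (by simp [Finset.filter_singleton])
      (by simp [Finset.filter_insert, Finset.filter_singleton, huw.not_gt])
    rw [clusterWeight_singleton, clusterWeight_singleton,
      clusterWeight_pair A B (hpu.trans huw)] at h1 h2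
    rw [clusterWeight_pair A B hpu] at h1
    rw [clusterWeight_pair A B huw] at h2
    constructor <;> linarith
  have high : ∀ v w, u < v → v < w → w ≤ n →
      A v w + A w v + B v = A u v + A v u + B w := by
    intro v w huv hvw hwn
    have h1 := H {u} {v, w} {u, v} {w} (by ext; simp; tauto)
      (by intro x; simp; omega) (by grind) (by simp; omega) (by simp; omega)
      (by simp) (by simp) (by simp) (by simp)
      (by simp [Finset.filter_singleton])
      (by simp [Finset.filter_insert, Finset.filter_singleton, huv.not_gt])
    rw [clusterWeight_singleton, clusterWeight_singleton, clusterWeight_pair A B hvw,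
      clusterWeight_pair A B huv] at h1
    linarith
  have mix₂ : ∀ w, u < w → w ≤ n → A 1 w + A w 1 + (A 2 w + A w 2) = A u w + A w u := by
    intro w huw hwn
    have h1 := H {u} {1, 2, w} {u, w} {1, 2} (by ext; simp; tauto)
      (by intro x; simp; omega) (by grind) (by simp; omega) (by simp; omega)
      (by simp) (by simp) (by simp) (by simp)
      (by simp [Finset.filter_singleton])
      (by simp [Finset.filter_insert, Finset.filter_singleton, huw.not_gt])
    rw [clusterWeight_singleton, clusterWeight_triple A B (by omega) (by omega),
      clusterWeight_pair A B huw, clusterWeight_pair A B (by omega)] at h1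
    linarith
  have hB1 := hB 1 (by omega)
  have hB2 := hB 2 (by omega)
  have hB3 := hB 3 (by omega)
  have hβ : A 1 u + A u 1 = 0 := by
    have h12 := low₁ 1 2 (by omega) (by omega) (by omega)
    have h13 := low₁ 1 3 (by omega) (by omega) (by omega)
    have h23 := low₁ 2 3 (by omega) (by omega) (by omega)
    have h123 := low₂ 1 2 3 (by omega) (by omega) (by omega) (by omega)
    linarith [h12.1, h12.2, h13.1, h13.2, h23.1, h23.2]
  have hlow : ∀ p, 1 ≤ p → p < u → A p u + A u p = 0 := by
    intro p hp hpu
    rcases hp.eq_or_lt with rfl | h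
    · exact hβ
    · linarith [(low₁ 1 p le_rfl h hpu).1]
  have hBlow : ∀ q, 1 ≤ q → q < u → B q = 0 := by
    intro q hq hqu
    by_cases hq3 : q ≤ 3
    · exact hB q hq3
    · have h1 := low₁ 1 q (by omega) (by omega) hqu
      have h2 := low₁ 2 q (by omega) (by omega) hqu
      have h := low₂ 1 2 q (by omega) (by omega) (by omega) hqu
      linarith [h1.1, h1.2, h2.1, h2.2, hlow q hq hqu]
  have hBhigh : ∀ w, u < w → w ≤ n → B w = 0 := by
    intro w huw hwn
    have h1 := mix₁ 1 w (by omega) (by omega) huw hwn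
    have h2 := mix₁ 2 w (by omega) (by omega) huw hwn
    linarith [h1.1, h1.2, h2.1, h2.2, mix₂ w huw hwn, hβ]
  have huw0 : ∀ w, u < w → w ≤ n → A u w + A w u = 0 := by
    intro w huw hwn
    have h1 := mix₁ 1 w (by omega) (by omega) huw hwn
    linarith [h1.1, h1.2, hBhigh w huw hwn]
  constructor
  · intro i hi j hj hij
    rw [Finset.mem_Icc] at hi hj
    rcases lt_trichotomy j u with hju | rfl | huj
    · linarith [(low₁ i j hi.1 hij hju).2, hlow j hj.1 hju, hBlow j hj.1 hju]
    · exact hlow i hi.1 hij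
    · rcases lt_trichotomy i u with hiu | rfl | hui
      · linarith [(mix₁ i j hi.1 hiu huj hj.2).2, huw0 j huj hj.2]
      · exact huw0 j hij hj.2
      · linarith [high i j hui hij hj.2, hBhigh i hui hi.2, hBhigh j huj hj.2, huw0 i hui hi.2]
  · intro v hv
    rw [Finset.mem_Icc] at hv
    rcases lt_trichotomy v u with h | rfl | h
    · exact hBlow v hv.1 h
    · exact hBu
    · exact hBhigh v h hv.2

/-- Two clusters covering a set `s` of at most four vertices extend to a `K`-partition, and
the other clusters can be chosen to depend on `s` only. -/
theorem exists_kPartition_of_two_clusters {n K : ℕ} (hn : 5 ≤ n) (hK1 : 3 ≤ K)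
    (hK2 : K ≤ n - 2) {s : Finset ℕ} (hs : s ⊆ Finset.Icc 1 n) (hs4 : s.card ≤ 4) :
    ∃ R : Finset (Finset ℕ), ∀ C C' : Finset ℕ, C ∪ C' = s → Disjoint C C' → C.Nonempty →
      C'.Nonempty → ∃ π : KPartition n K, C ∈ π.parts ∧
        ∀ W : Finset ℕ → ℝ, ∑ D ∈ π.parts, W D = W C + W C' + ∑ D ∈ R, W D := by
  have hcard : (Finset.Icc 1 n \ s).card = n - s.card := by
    rw [Finset.card_sdiff_of_subset hs]; simp
  obtain ⟨P, -, hP⟩ := Finpartition.exists_equipartition_card_eq (Finset.Icc 1 n \ s)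
    (n := K - 2) (by omega) (by omega)
  have hPs : ∀ D ∈ P.parts, Disjoint s D := fun D hD =>
    Finset.disjoint_of_subset_right (P.le hD) Finset.disjoint_sdiff
  refine ⟨P.parts, fun C C' hCs hCC' hC hC' => ?_⟩
  have hCP : ∀ D ∈ P.parts, Disjoint C D := fun D hD =>
    Finset.disjoint_of_subset_left (hCs ▸ Finset.subset_union_left) (hPs D hD)
  have hCP' : ∀ D ∈ P.parts, Disjoint C' D := fun D hD =>
    Finset.disjoint_of_subset_left (hCs ▸ Finset.subset_union_right) (hPs D hD)
  have h' : C' ∉ P.parts := fun h => hC'.ne_empty (disjoint_self.1 (hCP' C' h))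
  have h : C ∉ insert C' P.parts := by
    rw [Finset.mem_insert, not_or]
    refine ⟨?_, fun h => hC.ne_empty (disjoint_self.1 (hCP C h))⟩
    rintro rfl
    exact hC.ne_empty (disjoint_self.1 hCC')
  refine ⟨⟨insert C (insert C' P.parts), ?_, ?_, ?_, ?_⟩, Finset.mem_insert_self _ _, fun W => ?_⟩
  · rw [Finset.card_insert_of_notMem h, Finset.card_insert_of_notMem h']
    omega
  · simp only [Finset.mem_insert]
    rintro D (rfl | rfl | hD)
    exacts [hC, hC', P.nonempty_of_mem_parts hD]
  · simp only [Finset.mem_insert]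
    rintro D (rfl | rfl | hD) E (rfl | rfl | hE) hne
    exacts [absurd rfl hne, hCC', hCP _ hE, hCC'.symm, absurd rfl hne, hCP' _ hE,
      (hCP _ hD).symm, (hCP' _ hD).symm, P.disjoint hD hE hne]
  · rw [Finset.sup_insert, Finset.sup_insert, P.sup_parts, id, id, ← sup_assoc]
    change C ∪ C' ∪ (Finset.Icc 1 n \ s) = _
    rw [hCs, Finset.union_sdiff_of_subset hs]
  · rw [Finset.sum_insert h, Finset.sum_insert h']
    ring

namespace KPartition

variable {n K : ℕ} (π : KPartition n K)

theorem subset_Icc {C : Finset ℕ} (hC : C ∈ π.parts) : C ⊆ Finset.Icc 1 n := by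
  rw [← π.parts_cover]
  exact Finset.le_sup (f := id) hC

theorem eq_of_mem {C D : Finset ℕ} (hC : C ∈ π.parts) (hD : D ∈ π.parts) {v : ℕ} (hvC : v ∈ C)
    (hvD : v ∈ D) : C = D := by
  by_contra hne
  exact Finset.disjoint_left.1 (π.parts_disjoint C hC D hD hne) hvC hvD

theorem exists_mem {v : ℕ} (hv : v ∈ Finset.Icc 1 n) : ∃ C ∈ π.parts, v ∈ C := by
  rw [← π.parts_cover] at hv
  simpa [Finset.mem_sup] using hv

theorem pairwiseDisjoint : (π.parts : Set (Finset ℕ)).PairwiseDisjoint id :=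
  fun C hC D hD hne => π.parts_disjoint C hC D hD hne

theorem sum_parts (f : ℕ → ℝ) : ∑ C ∈ π.parts, ∑ v ∈ C, f v = ∑ v ∈ Finset.Icc 1 n, f v := by
  rw [← π.parts_cover, Finset.sup_eq_biUnion, Finset.sum_biUnion π.pairwiseDisjoint]
  rfl

end KPartition

theorem finite_setOf_charVec (n K : ℕ) :
    {x | ∃ π : KPartition n K, x = charVec n K π}.Finite := by
  have : Finite (KPartition n K) := by
    refine Finite.of_injective (β := (Finset.Icc 1 n).powerset.powerset)
      (fun π => ⟨π.parts, ?_⟩) ?_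
    · rw [Finset.mem_powerset]
      exact fun C hC => Finset.mem_powerset.2 (π.subset_Icc hC)
    · rintro ⟨P, _, _, _, _⟩ ⟨Q, _, _, _, _⟩ h
      simpa using h
  convert Set.finite_range (charVec n K) using 1
  ext x
  simp [eq_comm]

/-- The left-hand side of the lower representative inequality. -/
noncomputable def lowerRep (u : ℕ) : GPoint →ₗ[ℝ] ℝ :=
  LinearMap.proj u ∘ₗ LinearMap.snd ℝ (ℕ × ℕ → ℝ) (ℕ → ℝ) +
    ∑ i ∈ Finset.Icc 1 (u - 1), LinearMap.proj (i, u) ∘ₗ LinearMap.fst ℝ (ℕ × ℕ → ℝ) (ℕ → ℝ)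

theorem lowerRep_apply (u : ℕ) (x : GPoint) :
    lowerRep u x = x.2 u + ∑ i ∈ Finset.Icc 1 (u - 1), x.1 (i, u) := by
  simp [lowerRep]

theorem lowerRep_charVec {n K u : ℕ} (π : KPartition n K) (hu : 4 ≤ u) {C : Finset ℕ}
    (hC : C ∈ π.parts) (huC : u ∈ C) :
    lowerRep u (charVec n K π) =
      (if (C.filter (· < u)).card = 0 then 1 else 0) + ((C.filter (· < u)).card : ℝ) := by
  have hmem : ∀ p, (∃ D ∈ π.parts, p ∈ D ∧ u ∈ D) ↔ p ∈ C := by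
    refine fun p => ⟨?_, fun h => ⟨C, hC, h, huC⟩⟩
    rintro ⟨D, hD, hpD, huD⟩
    rwa [π.eq_of_mem hC hD huC huD]
  have hrep : (4 ≤ u ∧ ∃ D ∈ π.parts, u ∈ D ∧ ∀ w ∈ D, u ≤ w) ↔
      (C.filter (· < u)).card = 0 := by
    simp only [Finset.card_eq_zero, Finset.filter_eq_empty_iff, not_lt]
    refine ⟨?_, fun h => ⟨hu, C, hC, huC, fun w hw => h hw⟩⟩
    rintro ⟨-, D, hD, huD, h⟩ w hw
    exact h w (π.eq_of_mem hC hD huC huD ▸ hw)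
  rw [lowerRep_apply]
  simp only [charVec, hmem, hrep]
  congr 1
  rw [Finset.sum_boole]
  congr 2
  ext i
  have := π.subset_Icc hC
  simp only [Finset.mem_filter, Finset.mem_Icc]
  constructor
  · rintro ⟨h, hi⟩
    exact ⟨hi, by omega⟩
  · rintro ⟨hi, h⟩
    have := Finset.mem_Icc.1 (this hi)
    exact ⟨by omega, hi⟩

/-- The edge coefficients of a linear functional. -/
noncomputable def edgeCoeff (φ : GPoint →ₗ[ℝ] ℝ) (i j : ℕ) : ℝ := φ (Pi.single (i, j) 1, 0)

/-- The representative coefficients of a linear functional. -/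
noncomputable def repCoeff (φ : GPoint →ₗ[ℝ] ℝ) (v : ℕ) : ℝ :=
  if 4 ≤ v then φ (0, Pi.single v 1) else 0

open Classical in
theorem charVec_eq_sum {n K : ℕ} (π : KPartition n K) :
    charVec n K π = ∑ C ∈ π.parts,
      ((∑ i ∈ C, ∑ j ∈ C, ((Pi.single (i, j) 1, 0) : GPoint)) +
        ∑ v ∈ C, if (∀ w ∈ C, v ≤ w) ∧ 4 ≤ v then ((0, Pi.single v 1) : GPoint) else 0) := by
  refine Prod.ext (funext fun p => ?_) (funext fun v => ?_)
  · obtain ⟨p, q⟩ := p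
    have key : ∀ C : Finset ℕ, (∑ i ∈ C, ∑ j ∈ C, (Pi.single (i, j) 1 : ℕ × ℕ → ℝ) (p, q)) =
        if p ∈ C ∧ q ∈ C then 1 else 0 := by
      intro C
      simp only [Pi.single_apply, Prod.mk.injEq, ite_and, Finset.sum_ite_irrel, Finset.sum_ite_eq,
        Finset.sum_const_zero]
    have key' : ∀ C : Finset ℕ, (∑ v ∈ C, (if (∀ w ∈ C, v ≤ w) ∧ 4 ≤ v then
        ((0, Pi.single v 1) : GPoint) else 0).1 (p, q)) = 0 := by
      intro C
      refine Finset.sum_eq_zero fun v _ => ?_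
      split_ifs <;> rfl
    simp only [Prod.fst_sum, Prod.fst_add, Finset.sum_apply, Pi.add_apply, key, key', add_zero]
    simp only [charVec]
    split_ifs with h
    · obtain ⟨C, hC, hp, hq⟩ := h
      rw [Finset.sum_eq_single_of_mem C hC, if_pos ⟨hp, hq⟩]
      exact fun D hD hne => if_neg fun h => hne (π.eq_of_mem hD hC h.1 hp)
    · exact (Finset.sum_eq_zero fun C hC => if_neg fun h' => h ⟨C, hC, h'⟩).symm
  · have key : ∀ C : Finset ℕ, (∑ x ∈ C, (if (∀ w ∈ C, x ≤ w) ∧ 4 ≤ x then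
        ((0, Pi.single x 1) : GPoint) else 0).2 v) =
        if v ∈ C ∧ (∀ w ∈ C, v ≤ w) ∧ 4 ≤ v then 1 else 0 := by
      intro C
      have : ∀ x, (if (∀ w ∈ C, x ≤ w) ∧ 4 ≤ x then ((0, Pi.single x 1) : GPoint) else 0).2 v =
          if v = x then (if (∀ w ∈ C, v ≤ w) ∧ 4 ≤ v then 1 else 0) else 0 := by
        intro x
        by_cases hx : v = x
        · subst hx
          rw [if_pos rfl]
          split_ifs <;> simp
        · rw [if_neg hx]
          split_ifs <;> simp [hx]
      simp only [this, Finset.sum_ite_eq]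
      simp only [ite_and]
    simp only [Prod.snd_sum, Prod.snd_add, Finset.sum_apply, key,
      Finset.sum_const_zero, zero_add]
    simp only [charVec]
    split_ifs with h
    · obtain ⟨h4, C, hC, hv, hmin⟩ := h
      rw [Finset.sum_eq_single_of_mem C hC, if_pos ⟨hv, hmin, h4⟩]
      exact fun D hD hne => if_neg fun h => hne (π.eq_of_mem hD hC h.1 hv)
    · exact (Finset.sum_eq_zero fun C hC =>
        if_neg fun h' => h ⟨h'.2.2, C, hC, h'.1, h'.2.1⟩).symm

theorem map_charVec {n K : ℕ} (φ : GPoint →ₗ[ℝ] ℝ) (π : KPartition n K) :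
    φ (charVec n K π) = ∑ C ∈ π.parts, clusterWeight (edgeCoeff φ) (repCoeff φ) C := by
  classical
  rw [charVec_eq_sum, map_sum]
  refine Finset.sum_congr rfl fun C _ => ?_
  simp only [map_add, map_sum, clusterWeight, edgeCoeff, repCoeff]
  congr 1
  refine Finset.sum_congr rfl fun v _ => ?_
  rw [ite_and]
  split_ifs <;> simp

/-- A functional that is constant on the characteristic vectors in the face and does not
involve the representative coordinate of `u` is constant on all characteristic vectors. -/
theorem map_charVec_const {n K u : ℕ} (hn : 5 ≤ n) (hK1 : 3 ≤ K) (hK2 : K ≤ n - 2)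
    (hu4 : 4 ≤ u) (hun : u ≤ n) (φ : GPoint →ₗ[ℝ] ℝ) (hφu : φ (0, Pi.single u 1) = 0)
    (hφ : ∀ π ρ : KPartition n K, lowerRep u (charVec n K π) = 1 →
      lowerRep u (charVec n K ρ) = 1 → φ (charVec n K π) = φ (charVec n K ρ))
    (π ρ : KPartition n K) : φ (charVec n K π) = φ (charVec n K ρ) := by
  have hface : ∀ (π : KPartition n K) (C : Finset ℕ), C ∈ π.parts → u ∈ C →
      (C.filter (· < u)).card ≤ 1 → lowerRep u (charVec n K π) = 1 := by
    intro π C hC huC h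
    rw [lowerRep_charVec π hu4 hC huC]
    interval_cases (C.filter (· < u)).card <;> simp
  obtain ⟨hA, hB⟩ := coefficients_eq_zero (n := n) (edgeCoeff φ) (repCoeff φ) hu4 hun
    (fun v hv => by simp [repCoeff]; omega) (by simp [repCoeff, hφu]) (by
      intro C C' D D' hCD hsub hcard hC hD hC' hD' huC huD hCu hDu
      obtain ⟨R, hR⟩ := exists_kPartition_of_two_clusters hn hK1 hK2 hsub hcard
      obtain ⟨π, hπ, hπW⟩ := hR C C' rfl hC ⟨u, huC⟩ hC'
      obtain ⟨ρ, hρ, hρW⟩ := hR D D' hCD.symm hD ⟨u, huD⟩ hD'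
      have := hφ π ρ (hface π C hπ huC hCu) (hface ρ D hρ huD hDu)
      rw [map_charVec, map_charVec, hπW, hρW] at this
      linarith)
  have hconst : ∀ π : KPartition n K,
      φ (charVec n K π) = ∑ v ∈ Finset.Icc 1 n, edgeCoeff φ v v := by
    intro π
    rw [map_charVec, ← π.sum_parts]
    refine Finset.sum_congr rfl fun C hC => ?_
    have hCn := π.subset_Icc hC
    have hrep : (∑ v ∈ C, if ∀ w ∈ C, v ≤ w then repCoeff φ v else 0) = 0 :=
      Finset.sum_eq_zero fun v hv => by rw [hB v (hCn hv), ite_self]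
    have hswap : ∑ i ∈ C, ∑ j ∈ C, edgeCoeff φ i j = ∑ i ∈ C, ∑ j ∈ C, edgeCoeff φ j i :=
      Finset.sum_comm
    have hsum : ∑ i ∈ C, ∑ j ∈ C, (edgeCoeff φ i j + edgeCoeff φ j i) =
        ∑ i ∈ C, 2 * edgeCoeff φ i i := by
      refine Finset.sum_congr rfl fun i hi => ?_
      rw [Finset.sum_eq_single_of_mem i hi, two_mul]
      intro j hj hne
      rcases hne.lt_or_gt with h | h
      · rw [add_comm]
        exact hA j (hCn hj) i (hCn hi) h
      · exact hA i (hCn hi) j (hCn hj) h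
    simp only [Finset.sum_add_distrib] at hsum
    rw [← Finset.mul_sum] at hsum
    simp only [clusterWeight]
    rw [hrep]
    linarith
  rw [hconst, hconst]

/-- If the direction of `s` is the kernel, within the direction of `t`, of a functional that is
not constant on `t`, then the dimensions differ by one. -/
theorem adim_add_one {s t : Set GPoint} (ht : FiniteDimensional ℝ (affineSpan ℝ t).direction)
    (l : GPoint →ₗ[ℝ] ℝ)
    (hst : (affineSpan ℝ s).direction = (affineSpan ℝ t).direction ⊓ LinearMap.ker l)
    (hl : ∃ x ∈ t, ∃ y ∈ t, l x ≠ l y) : adim s + 1 = adim t := by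
  obtain ⟨x, hx, y, hy, hxy⟩ := hl
  have hne : l.domRestrict (affineSpan ℝ t).direction ≠ 0 := by
    intro h
    have hmem : x -ᵥ y ∈ (affineSpan ℝ t).direction :=
      AffineSubspace.vsub_mem_direction (mem_affineSpan ℝ hx) (mem_affineSpan ℝ hy)
    have := LinearMap.congr_fun h ⟨_, hmem⟩
    simp [sub_eq_zero] at this
    exact hxy this
  have hker : (LinearMap.ker (l.domRestrict (affineSpan ℝ t).direction)).map
      (affineSpan ℝ t).direction.subtype = (affineSpan ℝ s).direction := by
    rw [hst]
    ext z
    simp [and_comm]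
  unfold adim
  rw [← hker, Submodule.finrank_map_subtype_eq]
  exact Module.Dual.finrank_ker_add_one_of_ne_zero hne

/-- For `n ≥ 5`, `3 ≤ K ≤ n-2` and `u ∈ {4,…,n}`, the lower representative inequality
`x_u + Σ_{i=1}^{u-1} x_{i,u} ≥ 1` is facet-defining for `P_{n,K}`. -/
theorem lower_rep_facet (n K u : ℕ) (hn : 5 ≤ n) (hK1 : 3 ≤ K) (hK2 : K ≤ n - 2)
    (hu : u ∈ Finset.Icc 4 n) :
    IsFacetGe n K (fun x => x.2 u + ∑ i ∈ Finset.Icc 1 (u - 1), x.1 (i, u)) 1 := by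
  obtain ⟨hu4, hun⟩ := Finset.mem_Icc.1 hu
  simp only [← lowerRep_apply]
  have hvertex : ∀ π : KPartition n K, charVec n K π ∈ PolyP n K := fun π =>
    subset_convexHull ℝ _ ⟨π, rfl⟩
  have hspan : affineSpan ℝ (PolyP n K) =
      affineSpan ℝ {x | ∃ π : KPartition n K, x = charVec n K π} := affineSpan_convexHull _
  refine ⟨fun x hx => ?_, adim_add_one ?_ (lowerRep u) (le_antisymm ?_ ?_) ?_⟩
  · refine convexHull_min (t := {x | 1 ≤ lowerRep u x}) ?_
      (convex_halfSpace_ge (lowerRep u).isLinear 1) hx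
    rintro _ ⟨π, rfl⟩
    obtain ⟨C, hC, huC⟩ := π.exists_mem (v := u) (Finset.mem_Icc.2 ⟨by omega, hun⟩)
    rw [Set.mem_ofPred_eq, lowerRep_charVec π hu4 hC huC]
    split_ifs with h
    · simp
    · rw [zero_add]
      exact_mod_cast Nat.one_le_iff_ne_zero.2 h
  · rw [hspan, direction_affineSpan]
    exact finiteDimensional_vectorSpan_of_finite ℝ (finite_setOf_charVec n K)
  · refine le_inf (AffineSubspace.direction_le (affineSpan_mono ℝ fun x hx => hx.1)) ?_
    rw [direction_affineSpan, vectorSpan_def, Submodule.span_le]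
    rintro _ ⟨x, hx, y, hy, rfl⟩
    simp [hx.2, hy.2]
  · rintro x ⟨hxP, hxl⟩
    by_contra hxF
    obtain ⟨φ, hφx, hφ⟩ := Submodule.exists_le_ker_of_notMem hxF
    refine hφx ?_
    set c := φ (0, Pi.single u 1)
    have hlu : lowerRep u (0, Pi.single u 1) = 1 := by simp [lowerRep_apply]
    have hconst := map_charVec_const (K := K) hn hK1 hK2 hu4 hun (φ - c • lowerRep u)
      (by simp [hlu, c]) (by
        intro π ρ hπ hρ
        have hmem := hφ (AffineSubspace.vsub_mem_direction
          (mem_affineSpan ℝ (show charVec n K π ∈ {x | x ∈ PolyP n K ∧ lowerRep u x = 1} from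
            ⟨hvertex π, hπ⟩))
          (mem_affineSpan ℝ (show charVec n K ρ ∈ {x | x ∈ PolyP n K ∧ lowerRep u x = 1} from
            ⟨hvertex ρ, hρ⟩)))
        rw [LinearMap.mem_ker, vsub_eq_sub, map_sub, sub_eq_zero] at hmem
        simp [hπ, hρ, hmem])
    have hker : (affineSpan ℝ (PolyP n K)).direction ≤ LinearMap.ker (φ - c • lowerRep u) := by
      rw [hspan, direction_affineSpan, vectorSpan_def, Submodule.span_le]
      rintro _ ⟨_, ⟨π, rfl⟩, _, ⟨ρ, rfl⟩, rfl⟩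
      change (φ - c • lowerRep u) (charVec n K π - charVec n K ρ) = 0
      rw [map_sub, hconst π ρ, sub_self]
    have := hker hxP
    rw [LinearMap.mem_ker, LinearMap.sub_apply, LinearMap.smul_apply,
      LinearMap.mem_ker.1 hxl] at this
    simpa using this
  · have hs : ({1, 2, 3, u} : Finset ℕ) ⊆ Finset.Icc 1 n := by intro x; simp; omega
    obtain ⟨R, hR⟩ := exists_kPartition_of_two_clusters hn hK1 hK2 hs Finset.card_le_four
    obtain ⟨π, hπ, -⟩ := hR {1, 2, u} {3} (by ext; simp; tauto) (by simp; omega) (by simp)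
      (by simp)
    obtain ⟨ρ, hρ, -⟩ := hR {u} {1, 2, 3} (by ext; simp; tauto) (by simp; omega) (by simp)
      (by simp)
    refine ⟨_, hvertex π, _, hvertex ρ, ?_⟩
    rw [lowerRep_charVec π hu4 hπ (by simp), lowerRep_charVec ρ hu4 hρ (by simp)]
    have h1 : 1 < u := by omega
    have h2 : 2 < u := by omega
    simp [Finset.filter_insert, Finset.filter_singleton, h1, h2]
end

section
/- Let n ≥ 5 and 3 ≤ K ≤ n−2. The inequality x_{1,2} + x_{1,3} + x_{2,3} − Σ_{i=4}^{n} x_i ≥ 3 − K (which expresses the lower representative inequality x_3 + x_{1,3} + x_{2,3} ≥ 1 in the variables of P_{n,K}) is facet-defining for P_{n,K}. -/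
/-- `v` is the smallest vertex of its class under the labelling `g` of `{1,…,n}`. -/
def IsClassMin (n : ℕ) (g : ℕ → ℕ) (v : ℕ) : Prop :=
  ∀ w ∈ Finset.Icc 1 n, g w = g v → v ≤ w

open Classical in
/-- The characteristic vector of the partition of `{1,…,n}` into the classes of `g`. -/
noncomputable def labelVec (n : ℕ) (g : ℕ → ℕ) : GPoint :=
  ⟨fun p => if p.1 ∈ Finset.Icc 1 n ∧ p.2 ∈ Finset.Icc 1 n ∧ g p.1 = g p.2 then 1 else 0,
   fun v => if v ∈ Finset.Icc 4 n ∧ IsClassMin n g v then 1 else 0⟩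

/-- `g` takes exactly `K` values on `{1,…,n}`. -/
def IsLabelling (n K : ℕ) (g : ℕ → ℕ) : Prop :=
  ((Finset.Icc 1 n).image g).card = K

/-- The vertices `1, 2, 3` are not all in the same class of `g`. -/
def Splits (g : ℕ → ℕ) : Prop := ¬ (g 1 = g 2 ∧ g 1 = g 3)

theorem exists_charVec_eq_labelVec {n K : ℕ} {g : ℕ → ℕ} (hg : IsLabelling n K g) :
    ∃ π : KPartition n K, charVec n K π = labelVec n g := by
  classical
  let cls : ℕ → Finset ℕ := fun k => (Finset.Icc 1 n).filter (fun v => g v = k)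
  refine ⟨⟨((Finset.Icc 1 n).image g).image cls, ?_, ?_, ?_, ?_⟩, ?_⟩
  · rw [Finset.card_image_of_injOn, hg]
    intro k hk l hl hkl
    simp only [Finset.coe_image, Set.mem_image, Finset.mem_coe] at hk
    obtain ⟨v, hv, rfl⟩ := hk
    have : v ∈ cls (g v) := by simp [cls] at hv ⊢; exact hv
    rw [hkl] at this
    exact (Finset.mem_filter.1 this).2
  · intro C hC
    simp only [Finset.mem_image] at hC
    obtain ⟨_, ⟨v, hv, rfl⟩, rfl⟩ := hC
    exact ⟨v, Finset.mem_filter.2 ⟨hv, rfl⟩⟩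
  · intro C hC D hD hne
    simp only [Finset.mem_image] at hC hD
    obtain ⟨k, _, rfl⟩ := hC
    obtain ⟨l, _, rfl⟩ := hD
    rw [Finset.disjoint_left]
    intro v hv hv'
    apply hne
    rw [← (Finset.mem_filter.1 hv).2, ← (Finset.mem_filter.1 hv').2]
  · ext v
    simp only [Finset.mem_sup, Finset.mem_image, id]
    constructor
    · rintro ⟨_, ⟨k, _, rfl⟩, hv⟩
      exact (Finset.mem_filter.1 hv).1
    · intro hv
      exact ⟨_, ⟨_, ⟨v, hv, rfl⟩, rfl⟩, Finset.mem_filter.2 ⟨hv, rfl⟩⟩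
  · refine Prod.ext (funext fun p => ?_) (funext fun v => ?_)
    · refine if_congr ?_ rfl rfl
      simp only [Finset.mem_image]
      constructor
      · rintro ⟨_, ⟨k, _, rfl⟩, h1, h2⟩
        rw [Finset.mem_filter] at h1 h2
        exact ⟨h1.1, h2.1, h1.2.trans h2.2.symm⟩
      · rintro ⟨h1, h2, h3⟩
        exact ⟨_, ⟨_, ⟨p.1, h1, rfl⟩, rfl⟩, Finset.mem_filter.2 ⟨h1, rfl⟩,
          Finset.mem_filter.2 ⟨h2, h3.symm⟩⟩
    · refine if_congr ?_ rfl rfl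
      simp only [Finset.mem_image]
      constructor
      · rintro ⟨h4, _, ⟨k, _, rfl⟩, h1, h2⟩
        rw [Finset.mem_filter] at h1
        refine ⟨Finset.mem_Icc.2 ⟨h4, (Finset.mem_Icc.1 h1.1).2⟩, fun w hw hwv => ?_⟩
        exact h2 w (Finset.mem_filter.2 ⟨hw, hwv.trans h1.2⟩)
      · rintro ⟨h1, h2⟩
        have hv : v ∈ Finset.Icc 1 n := by
          rw [Finset.mem_Icc] at h1 ⊢; omega
        refine ⟨(Finset.mem_Icc.1 h1).1, _, ⟨_, ⟨v, hv, rfl⟩, rfl⟩,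
          Finset.mem_filter.2 ⟨hv, rfl⟩, fun w hw => ?_⟩
        rw [Finset.mem_filter] at hw
        exact h2 w hw.1 hw.2

theorem exists_labelVec_eq_charVec {n K : ℕ} (π : KPartition n K) :
    ∃ g, IsLabelling n K g ∧ charVec n K π = labelVec n g := by
  classical
  have hex : ∀ v ∈ Finset.Icc 1 n, ∃ C ∈ π.parts, v ∈ C := by
    intro v hv
    rw [← π.parts_cover, Finset.mem_sup] at hv
    exact hv
  have hsub : ∀ C ∈ π.parts, ∀ v ∈ C, v ∈ Finset.Icc 1 n := by
    intro C hC v hv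
    rw [← π.parts_cover, Finset.mem_sup]
    exact ⟨C, hC, hv⟩
  have huniq : ∀ C ∈ π.parts, ∀ D ∈ π.parts, ∀ v, v ∈ C → v ∈ D → C = D := by
    intro C hC D hD v h1 h2
    by_contra hne
    exact Finset.disjoint_left.1 (π.parts_disjoint C hC D hD hne) h1 h2
  choose! c hc hmem using hex
  have hclass : ∀ C ∈ π.parts, ∀ v ∈ C, c v = C := fun C hC v hv =>
    huniq _ (hc v (hsub C hC v hv)) _ hC v (hmem v (hsub C hC v hv)) hv
  have hinj : ∀ {C D : Finset ℕ}, Encodable.encode C = Encodable.encode D ↔ C = D :=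
    Encodable.encode_inj
  refine ⟨fun v => Encodable.encode (c v), ?_, ?_⟩
  · have : (Finset.Icc 1 n).image (fun v => Encodable.encode (c v))
        = π.parts.image Encodable.encode := by
      ext k
      simp only [Finset.mem_image]
      constructor
      · rintro ⟨v, hv, rfl⟩
        exact ⟨c v, hc v hv, rfl⟩
      · rintro ⟨C, hC, rfl⟩
        obtain ⟨v, hv⟩ := π.parts_nonempty C hC
        exact ⟨v, hsub C hC v hv, by rw [hclass C hC v hv]⟩
    rw [IsLabelling, this, Finset.card_image_of_injective _ Encodable.encode_injective,
      π.card_parts]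
  · refine Prod.ext (funext fun p => ?_) (funext fun v => ?_)
    · refine if_congr ?_ rfl rfl
      rw [hinj]
      constructor
      · rintro ⟨C, hC, h1, h2⟩
        exact ⟨hsub C hC _ h1, hsub C hC _ h2, by rw [hclass C hC _ h1, hclass C hC _ h2]⟩
      · rintro ⟨h1, h2, h3⟩
        exact ⟨c p.1, hc _ h1, hmem _ h1, h3 ▸ hmem _ h2⟩
    · refine if_congr ?_ rfl rfl
      simp only [IsClassMin, hinj]
      constructor
      · rintro ⟨h4, C, hC, h1, h2⟩
        refine ⟨Finset.mem_Icc.2 ⟨h4, (Finset.mem_Icc.1 (hsub C hC v h1)).2⟩, ?_⟩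
        intro w hw hwv
        apply h2
        rw [← hclass C hC v h1, ← hwv]
        exact hmem w hw
      · rintro ⟨h1, h2⟩
        have hv : v ∈ Finset.Icc 1 n := by
          rw [Finset.mem_Icc] at h1 ⊢; omega
        refine ⟨(Finset.mem_Icc.1 h1).1, c v, hc v hv, hmem v hv, fun w hw => ?_⟩
        exact h2 w (hsub _ (hc v hv) w hw) (hclass _ (hc v hv) w hw)

theorem setOf_charVec_eq (n K : ℕ) :
    {x | ∃ π : KPartition n K, x = charVec n K π}
      = {x | ∃ g, IsLabelling n K g ∧ x = labelVec n g} := by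
  ext x
  constructor
  · rintro ⟨π, rfl⟩
    exact exists_labelVec_eq_charVec π
  · rintro ⟨g, hg, rfl⟩
    obtain ⟨π, hπ⟩ := exists_charVec_eq_labelVec hg
    exact ⟨π, hπ.symm⟩

instance (n K : ℕ) : Finite (KPartition n K) := by
  refine Finite.of_injective
    (fun π => (⟨π.parts, Finset.mem_powerset.2 fun C hC => Finset.mem_powerset.2 ?_⟩ :
      (Finset.Icc 1 n).powerset.powerset)) ?_
  · rw [← π.parts_cover]
    exact Finset.le_sup (f := id) hC
  · rintro ⟨_, _, _, _, _⟩ ⟨_, _, _, _, _⟩ h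
    simpa using h

open Classical in
theorem sum_isClassMin {n K : ℕ} {g : ℕ → ℕ} (hg : IsLabelling n K g) :
    ∑ v ∈ Finset.Icc 1 n, (if IsClassMin n g v then (1 : ℝ) else 0) = K := by
  rw [Finset.sum_boole]
  norm_cast
  rw [← hg, ← Finset.card_image_of_injOn (f := g)]
  · congr 1
    ext k
    simp only [Finset.mem_image, Finset.mem_filter]
    constructor
    · rintro ⟨v, ⟨hv, _⟩, rfl⟩
      exact ⟨v, hv, rfl⟩
    · rintro ⟨v, hv, rfl⟩
      have hne : ((Finset.Icc 1 n).filter (fun w => g w = g v)).Nonempty :=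
        ⟨v, Finset.mem_filter.2 ⟨hv, rfl⟩⟩
      have hm := Finset.mem_filter.1 (Finset.min'_mem _ hne)
      refine ⟨Finset.min' _ hne, ⟨hm.1, fun w hw hwm => ?_⟩, hm.2⟩
      refine Finset.min'_le _ _ ?_
      rw [Finset.mem_filter]
      exact ⟨hw, hwm.trans hm.2⟩
  · intro v hv w hw hvw
    simp only [Finset.coe_filter, Set.mem_ofPred_eq] at hv hw
    exact le_antisymm (hv.2 w hw.1 hvw.symm) (hw.2 v hv.1 hvw)

open Classical in
theorem sum_labelVec_snd {n K : ℕ} (hn : 3 ≤ n) {g : ℕ → ℕ} (hg : IsLabelling n K g) :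
    ∑ v ∈ Finset.Icc 4 n, (labelVec n g).2 v
      = K - 1 - (if g 1 = g 2 then 0 else 1) - (if g 1 = g 3 ∨ g 2 = g 3 then 0 else 1) := by
  have hIcc : Finset.Icc 1 n = insert 1 (insert 2 (insert 3 (Finset.Icc 4 n))) := by
    ext v; simp only [Finset.mem_Icc, Finset.mem_insert]; omega
  have h := sum_isClassMin hg
  have h1 : IsClassMin n g 1 := fun w hw _ => (Finset.mem_Icc.1 hw).1
  have h2 : IsClassMin n g 2 ↔ ¬ g 1 = g 2 := by
    constructor
    · intro h hh
      have := h 1 (by simp; omega) hh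
      omega
    · intro h w hw hw2
      rw [Finset.mem_Icc] at hw
      by_contra hlt
      obtain rfl : w = 1 := by omega
      exact h hw2
  have h3 : IsClassMin n g 3 ↔ ¬ (g 1 = g 3 ∨ g 2 = g 3) := by
    constructor
    · rintro h (hh | hh)
      · have := h 1 (by simp; omega) hh
        omega
      · have := h 2 (by simp; omega) hh
        omega
    · intro h w hw hw2
      rw [Finset.mem_Icc] at hw
      by_contra hlt
      obtain rfl | rfl : w = 1 ∨ w = 2 := by omega
      · exact h (Or.inl hw2)
      · exact h (Or.inr hw2)
  rw [hIcc, Finset.sum_insert (by simp), Finset.sum_insert (by simp),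
    Finset.sum_insert (by simp), if_pos h1] at h
  simp only [h2, h3, ite_not] at h
  have hs : ∑ v ∈ Finset.Icc 4 n, (labelVec n g).2 v
      = ∑ v ∈ Finset.Icc 4 n, (if IsClassMin n g v then (1 : ℝ) else 0) :=
    Finset.sum_congr rfl fun v hv => by simp only [labelVec, hv, true_and]
  rw [hs]
  linarith

/-- The left-hand side of the lower representative inequality as a linear functional. -/
noncomputable def repFunctional (n : ℕ) : GPoint →ₗ[ℝ] ℝ where
  toFun x := x.1 (1, 2) + x.1 (1, 3) + x.1 (2, 3) - ∑ i ∈ Finset.Icc 4 n, x.2 i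
  map_add' x y := by simp [Finset.sum_add_distrib]; ring
  map_smul' c x := by simp [← Finset.mul_sum]; ring

theorem labelVec_fst {n : ℕ} {g : ℕ → ℕ} {u v : ℕ} (hu : u ∈ Finset.Icc 1 n)
    (hv : v ∈ Finset.Icc 1 n) :
    (labelVec n g).1 (u, v) = if g u = g v then 1 else 0 := by
  simp only [labelVec, hu, hv, true_and]

open Classical in
theorem repFunctional_labelVec {n K : ℕ} (hn : 3 ≤ n) {g : ℕ → ℕ} (hg : IsLabelling n K g) :
    repFunctional n (labelVec n g) = if Splits g then 3 - (K : ℝ) else 4 - K := by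
  have m1 : 1 ∈ Finset.Icc 1 n := by simp; omega
  have m2 : 2 ∈ Finset.Icc 1 n := by simp; omega
  have m3 : 3 ∈ Finset.Icc 1 n := by simp; omega
  simp only [repFunctional, LinearMap.coe_mk, AddHom.coe_mk, sum_labelVec_snd hn hg,
    labelVec_fst m1 m2, labelVec_fst m1 m3, labelVec_fst m2 m3, Splits]
  by_cases h12 : g 1 = g 2 <;> by_cases h13 : g 1 = g 3 <;> by_cases h23 : g 2 = g 3 <;>
    first
    | (exfalso; omega)
    | (have h32 : g 3 = g 2 ↔ g 2 = g 3 := eq_comm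
       simp only [h12, h13, h23, h32, if_true, if_false, or_self, or_true, or_false, and_self,
        and_true, and_false, not_true_eq_false, not_false_eq_true]; ring)

/-- The differences of tight vertices: the directions of the face. -/
noncomputable def tightSpan (n K : ℕ) : Submodule ℝ GPoint :=
  vectorSpan ℝ {x | ∃ g, IsLabelling n K g ∧ Splits g ∧ x = labelVec n g}

theorem sub_mem_tightSpan {n K : ℕ} {g h : ℕ → ℕ} (hg : IsLabelling n K g) (hgs : Splits g)
    (hh : IsLabelling n K h) (hhs : Splits h) :
    labelVec n g - labelVec n h ∈ tightSpan n K :=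
  vsub_mem_vectorSpan ℝ ⟨g, hg, hgs, rfl⟩ ⟨h, hh, hhs, rfl⟩

/-- There is a labelling in which `{a, b, c}` and `{d}` are classes. -/
theorem exists_isLabelling {n K : ℕ} (hK1 : 3 ≤ K) (hK2 : K ≤ n - 2) {a b c d : ℕ}
    (ha : a ∈ Finset.Icc 1 n) (hb : b ∈ Finset.Icc 1 n) (hc : c ∈ Finset.Icc 1 n)
    (hd : d ∈ Finset.Icc 1 n) (hnd : [a, b, c, d].Nodup) :
    ∃ g, IsLabelling n K g ∧ g a = c ∧ g b = c ∧ g c = c ∧ g d = d ∧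
      ∀ w ∈ Finset.Icc 1 n, w ≠ a → w ≠ b → w ≠ c → w ≠ d → g w ≠ c ∧ g w ≠ d := by
  classical
  simp only [List.nodup_cons, List.mem_cons, List.not_mem_nil, or_false, not_or,
    List.nodup_nil, and_true, not_false_eq_true] at hnd
  obtain ⟨⟨hab, hac, had⟩, ⟨hbc, hbd⟩, hcd⟩ := hnd
  have hsub : ({a, b, c, d} : Finset ℕ) ⊆ Finset.Icc 1 n := by
    intro w hw
    simp only [Finset.mem_insert, Finset.mem_singleton] at hw
    rcases hw with rfl | rfl | rfl | rfl <;> assumption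
  have hcard : (Finset.Icc 1 n \ {a, b, c, d}).card = n - 4 := by
    rw [Finset.card_sdiff_of_subset hsub, Nat.card_Icc]
    have : ({a, b, c, d} : Finset ℕ).card = 4 := by
      repeat rw [Finset.card_insert_of_notMem (by simp [*])]
      rw [Finset.card_singleton]
    omega
  obtain ⟨T, hT, hTc⟩ := Finset.exists_subset_card_eq
    (s := Finset.Icc 1 n \ {a, b, c, d}) (n := K - 2) (by omega)
  obtain ⟨t, ht⟩ : T.Nonempty := Finset.card_pos.1 (by omega)
  have hTmem : ∀ w ∈ T, w ∈ Finset.Icc 1 n ∧ w ≠ a ∧ w ≠ b ∧ w ≠ c ∧ w ≠ d := by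
    intro w hw
    simpa using hT hw
  obtain ⟨-, hta, htb, htc, htd⟩ := hTmem t ht
  let g : ℕ → ℕ := fun w =>
    if w = d then d else if w = a ∨ w = b ∨ w = c then c else if w ∈ T then w else t
  have hgT : ∀ w ∈ T, g w = w := by
    intro w hw
    obtain ⟨-, h1, h2, h3, h4⟩ := hTmem w hw
    simp [g, *]
  have hgo : ∀ w, w ≠ a → w ≠ b → w ≠ c → w ≠ d → g w ∈ T := by
    intro w h1 h2 h3 h4
    by_cases hw : w ∈ T
    · rwa [hgT w hw]
    · simp [g, *]
  have hgd : g d = d := by simp [g]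
  have hga : g a = c := by simp [g, had]
  have hgb : g b = c := by simp [g, hbd]
  have hgc : g c = c := by simp [g, hcd]
  refine ⟨g, ?_, hga, hgb, hgc, hgd, ?_⟩
  · have himg : (Finset.Icc 1 n).image g = insert c (insert d T) := by
      ext k
      simp only [Finset.mem_image, Finset.mem_insert]
      constructor
      · rintro ⟨w, hw, rfl⟩
        by_cases h1 : w = a
        · left; rw [h1, hga]
        by_cases h2 : w = b
        · left; rw [h2, hgb]
        by_cases h3 : w = c
        · left; rw [h3, hgc]
        by_cases h4 : w = d
        · right; left; rw [h4, hgd]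
        exact Or.inr (Or.inr (hgo w h1 h2 h3 h4))
      · rintro (rfl | rfl | hk)
        · exact ⟨_, hc, hgc⟩
        · exact ⟨_, hd, hgd⟩
        · exact ⟨k, (hTmem k hk).1, hgT k hk⟩
    rw [IsLabelling, himg, Finset.card_insert_of_notMem, Finset.card_insert_of_notMem, hTc]
    · omega
    · exact fun h => (hTmem d h).2.2.2.2 rfl
    · rw [Finset.mem_insert]
      rintro (h | h)
      · exact hcd h
      · exact (hTmem c h).2.2.2.1 rfl
  · intro w _ h1 h2 h3 h4
    obtain ⟨-, -, -, h5, h6⟩ := hTmem _ (hgo w h1 h2 h3 h4)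
    exact ⟨h5, h6⟩

/-- The unit vector of the edge `ab`. -/
noncomputable def edgeVec (a b : ℕ) : GPoint :=
  (Pi.single (a, b) 1 + Pi.single (b, a) 1, 0)

/-- Place `a` in the class `α` and `b` in the class `β`. -/
def relabel (g : ℕ → ℕ) (a b α β : ℕ) : ℕ → ℕ :=
  fun w => if w = a then α else if w = b then β else g w

theorem isLabelling_relabel {n K : ℕ} {g : ℕ → ℕ} (hg : IsLabelling n K g) {a b c d α β : ℕ}
    (hc : c ∈ Finset.Icc 1 n)
    (hd : d ∈ Finset.Icc 1 n) (hac : a ≠ c) (had : a ≠ d) (hbc : b ≠ c) (hbd : b ≠ d)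
    (hga : g a = g c) (hgb : g b = g c)
    (hα : α = g c ∨ α = g d) (hβ : β = g c ∨ β = g d) :
    IsLabelling n K (relabel g a b α β) := by
  classical
  rw [IsLabelling, ← hg]
  congr 1
  have hrc : relabel g a b α β c = g c := by simp [relabel, hac.symm, hbc.symm]
  have hrd : relabel g a b α β d = g d := by simp [relabel, had.symm, hbd.symm]
  ext k
  simp only [Finset.mem_image]
  constructor
  · rintro ⟨w, hw, rfl⟩
    unfold relabel
    split_ifs
    · rcases hα with rfl | rfl
      exacts [⟨c, hc, rfl⟩, ⟨d, hd, rfl⟩]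
    · rcases hβ with rfl | rfl
      exacts [⟨c, hc, rfl⟩, ⟨d, hd, rfl⟩]
    · exact ⟨w, hw, rfl⟩
  · rintro ⟨w, hw, rfl⟩
    by_cases h1 : w = a
    · exact ⟨c, hc, by rw [hrc, h1, hga]⟩
    by_cases h2 : w = b
    · exact ⟨c, hc, by rw [hrc, h2, hgb]⟩
    exact ⟨w, hw, by simp [relabel, h1, h2]⟩

theorem isClassMin_relabel_iff {n : ℕ} {g : ℕ → ℕ} {a b c d α β : ℕ}
    (hc : c ∈ Finset.Icc 1 3) (hd : d ∈ Finset.Icc 1 3) (hn : 3 ≤ n)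
    (hac : a ≠ c) (had : a ≠ d) (hbc : b ≠ c) (hbd : b ≠ d)
    (hga : g a = g c) (hgb : g b = g c)
    (hα : α = g c ∨ α = g d) (hβ : β = g c ∨ β = g d) {v : ℕ} (hv : 4 ≤ v) :
    IsClassMin n (relabel g a b α β) v ↔ IsClassMin n g v := by
  rw [Finset.mem_Icc] at hc hd
  have hrc : relabel g a b α β c = g c := by simp [relabel, hac.symm, hbc.symm]
  have hrd : relabel g a b α β d = g d := by simp [relabel, had.symm, hbd.symm]
  have key : ∀ h : ℕ → ℕ, IsClassMin n h v → h c ≠ h v ∧ h d ≠ h v := by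
    intro h hm
    constructor
    · intro hh
      have := hm c (by rw [Finset.mem_Icc]; omega) hh
      omega
    · intro hh
      have := hm d (by rw [Finset.mem_Icc]; omega) hh
      omega
  have hne : ∀ w, w ≠ a → w ≠ b → relabel g a b α β w = g w := by
    intro w h1 h2; simp [relabel, h1, h2]
  have hra : relabel g a b α β a = g c ∨ relabel g a b α β a = g d := by
    simpa [relabel] using hα
  have hrb : relabel g a b α β b = g c ∨ relabel g a b α β b = g d := by
    unfold relabel
    split_ifs <;> simp_all
  constructor
  · intro hm
    obtain ⟨k1, k2⟩ := key _ hm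
    rw [hrc] at k1
    rw [hrd] at k2
    have hva : v ≠ a := by rintro rfl; grind
    have hvb : v ≠ b := by rintro rfl; grind
    rw [hne v hva hvb] at k1 k2
    intro w hw hwv
    refine hm w hw ?_
    rw [hne v hva hvb, hne w (by rintro rfl; grind) (by rintro rfl; grind), hwv]
  · intro hm
    obtain ⟨k1, k2⟩ := key _ hm
    have hva : v ≠ a := by rintro rfl; grind
    have hvb : v ≠ b := by rintro rfl; grind
    intro w hw hwv
    rw [hne v hva hvb] at hwv
    refine hm w hw ?_
    rw [← hwv, hne w (by rintro rfl; grind) (by rintro rfl; grind)]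

theorem labelVec_relabel_second_difference {n : ℕ} {g : ℕ → ℕ} {a b c d : ℕ}
    (ha : a ∈ Finset.Icc 1 n) (hb : b ∈ Finset.Icc 1 n) (hab : a ≠ b)
    (hc : c ∈ Finset.Icc 1 3) (hd : d ∈ Finset.Icc 1 3) (hn : 3 ≤ n)
    (hac : a ≠ c) (had : a ≠ d) (hbc : b ≠ c) (hbd : b ≠ d)
    (hga : g a = g c) (hgb : g b = g c) (hgcd : g c ≠ g d) :
    (labelVec n (relabel g a b (g c) (g c)) - labelVec n (relabel g a b (g c) (g d)))
      - (labelVec n (relabel g a b (g d) (g c)) - labelVec n (relabel g a b (g d) (g d)))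
      = (2 : ℝ) • edgeVec a b := by
  refine Prod.ext (funext fun p => ?_) (funext fun v => ?_)
  · obtain ⟨u, v⟩ := p
    by_cases hu : u ∈ Finset.Icc 1 n
    · by_cases hv : v ∈ Finset.Icc 1 n
      · simp only [Prod.fst_sub, Pi.sub_apply, labelVec_fst hu hv, edgeVec, Prod.smul_fst,
          Pi.smul_apply, Pi.add_apply, Pi.single_apply, Prod.mk.injEq, smul_eq_mul, relabel]
        by_cases h1 : u = a <;> by_cases h2 : u = b <;> by_cases h3 : v = a <;>
          by_cases h4 : v = b <;> simp_all [eq_comm] <;> norm_num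
      · have h1 : ¬ (u = a ∧ v = b) := by rintro ⟨rfl, rfl⟩; exact hv hb
        have h2 : ¬ (u = b ∧ v = a) := by rintro ⟨rfl, rfl⟩; exact hv ha
        simp only [labelVec, edgeVec, Pi.single_apply, Prod.fst_sub, Pi.sub_apply, hv,
          Prod.smul_fst, Pi.smul_apply, Pi.add_apply, Prod.mk.injEq, h1, h2]
        simp
    · have h1 : ¬ (u = a ∧ v = b) := by rintro ⟨rfl, rfl⟩; exact hu ha
      have h2 : ¬ (u = b ∧ v = a) := by rintro ⟨rfl, rfl⟩; exact hu hb
      simp only [labelVec, edgeVec, Pi.single_apply, Prod.fst_sub, Pi.sub_apply, hu,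
        Prod.smul_fst, Pi.smul_apply, Pi.add_apply, Prod.mk.injEq, h1, h2]
      simp
  · have key : ∀ α β, (α = g c ∨ α = g d) → (β = g c ∨ β = g d) →
        (labelVec n (relabel g a b α β)).2 v = (labelVec n g).2 v := by
      intro α β hα hβ
      classical
      refine if_congr (and_congr_right fun hv => ?_) rfl rfl
      exact isClassMin_relabel_iff hc hd hn hac had hbc hbd hga hgb hα hβ (Finset.mem_Icc.1 hv).1
    simp [key, edgeVec]

theorem edgeVec_mem_of_anchors {n K : ℕ} (hK1 : 3 ≤ K) (hK2 : K ≤ n - 2) {a b c d : ℕ}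
    (ha : a ∈ Finset.Icc 1 n) (hb : b ∈ Finset.Icc 1 n)
    (hc : c ∈ Finset.Icc 1 3) (hd : d ∈ Finset.Icc 1 3) (hnd : [a, b, c, d].Nodup) :
    edgeVec a b ∈ tightSpan n K := by
  have hc' : c ∈ Finset.Icc 1 n := by rw [Finset.mem_Icc] at *; omega
  have hd' : d ∈ Finset.Icc 1 n := by rw [Finset.mem_Icc] at *; omega
  obtain ⟨g, hg, hga, hgb, hgc, hgd, -⟩ := exists_isLabelling hK1 hK2 ha hb hc' hd' hnd
  simp only [List.nodup_cons, List.mem_cons, List.not_mem_nil, or_false, not_or,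
    List.nodup_nil, and_true, not_false_eq_true] at hnd
  obtain ⟨⟨hab, hac, had⟩, ⟨hbc, hbd⟩, hcd⟩ := hnd
  have hga' : g a = g c := hga.trans hgc.symm
  have hgb' : g b = g c := hgb.trans hgc.symm
  have hgcd : g c ≠ g d := by rwa [hgc, hgd]
  have hs : ∀ α β, Splits (relabel g a b α β) := by
    rintro α β ⟨h1, h2⟩
    have hrc : relabel g a b α β c = g c := by simp [relabel, Ne.symm hac, Ne.symm hbc]
    have hrd : relabel g a b α β d = g d := by simp [relabel, Ne.symm had, Ne.symm hbd]
    apply hgcd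
    rw [← hrc, ← hrd]
    rw [Finset.mem_Icc] at hc hd
    obtain rfl | rfl | rfl : c = 1 ∨ c = 2 ∨ c = 3 := by omega
    all_goals obtain rfl | rfl | rfl : d = 1 ∨ d = 2 ∨ d = 3 := by omega
    all_goals simp_all
  have hl : ∀ α β, (α = g c ∨ α = g d) → (β = g c ∨ β = g d) →
      IsLabelling n K (relabel g a b α β) := fun α β hα hβ =>
    isLabelling_relabel hg hc' hd' hac had hbc hbd hga' hgb' hα hβ
  have h2 := labelVec_relabel_second_difference ha hb hab hc hd (by omega : 3 ≤ n)
    hac had hbc hbd hga' hgb' hgcd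
  have hmem : (2 : ℝ) • edgeVec a b ∈ tightSpan n K := by
    rw [← h2]
    refine sub_mem (sub_mem_tightSpan ?_ (hs _ _) ?_ (hs _ _))
      (sub_mem_tightSpan ?_ (hs _ _) ?_ (hs _ _)) <;> apply hl <;> simp
  exact (Submodule.smul_mem_iff _ two_ne_zero).1 hmem

theorem edgeVec_comm (a b : ℕ) : edgeVec a b = edgeVec b a := by
  simp [edgeVec, add_comm]

theorem edgeVec_mem_tightSpan {n K : ℕ} (hK1 : 3 ≤ K) (hK2 : K ≤ n - 2) {a b : ℕ}
    (ha : a ∈ Finset.Icc 1 n) (hb : b ∈ Finset.Icc 1 n) (hab : a ≠ b) (h4 : 4 ≤ a ∨ 4 ≤ b) :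
    edgeVec a b ∈ tightSpan n K := by
  wlog hb4 : 4 ≤ b generalizing a b
  · rw [edgeVec_comm]
    exact this hb ha hab.symm h4.symm (by omega)
  have hcd : ∃ c ∈ Finset.Icc 1 3, ∃ d ∈ Finset.Icc 1 3, c ≠ d ∧ a ≠ c ∧ a ≠ d := by
    by_cases h1 : a = 1
    · exact ⟨2, by simp, 3, by simp, by omega⟩
    by_cases h2 : a = 2
    · exact ⟨1, by simp, 3, by simp, by omega⟩
    · exact ⟨1, by simp, 2, by simp, by omega⟩
  obtain ⟨c, hc, d, hd, hcd, hac, had⟩ := hcd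
  refine edgeVec_mem_of_anchors hK1 hK2 ha hb hc hd ?_
  rw [Finset.mem_Icc] at hc hd
  have hbc : b ≠ c := by omega
  have hbd : b ≠ d := by omega
  simp [*]

/-- A finitely supported symmetric edge vector is a combination of edge unit vectors. -/
theorem edge_part_mem_tightSpan {n K : ℕ} (hK1 : 3 ≤ K) (hK2 : K ≤ n - 2) {y : ℕ × ℕ → ℝ}
    (hsymm : ∀ p, y p.swap = y p)
    (hsupp : ∀ p, y p ≠ 0 → p.1 ∈ Finset.Icc 1 n ∧ p.2 ∈ Finset.Icc 1 n ∧ p.1 ≠ p.2 ∧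
      (4 ≤ p.1 ∨ 4 ≤ p.2)) :
    ((y, 0) : GPoint) ∈ tightSpan n K := by
  have h2 : (2 : ℝ) • ((y, 0) : GPoint)
      = ∑ p ∈ Finset.Icc 1 n ×ˢ Finset.Icc 1 n, y p • edgeVec p.1 p.2 := by
    have hz : ∀ q, q ∉ Finset.Icc 1 n ×ˢ Finset.Icc 1 n → y q = 0 := by
      intro q hq
      by_contra h
      exact hq (Finset.mem_product.2 ⟨(hsupp q h).1, (hsupp q h).2.1⟩)
    refine Prod.ext (funext fun q => ?_) (funext fun v => ?_)
    · simp only [Prod.fst_sum, Finset.sum_apply, Prod.smul_fst, edgeVec, Pi.smul_apply,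
        Pi.add_apply, Pi.single_apply, smul_eq_mul, mul_add, Finset.sum_add_distrib, mul_ite,
        mul_one, mul_zero]
      have hsw : ∀ p : ℕ × ℕ, q = (p.2, p.1) ↔ q.swap = p := by
        rintro ⟨_, _⟩; obtain ⟨_, _⟩ := q; simp [and_comm]
      simp only [hsw, Prod.mk.eta, Finset.sum_ite_eq]
      have e1 : (if q ∈ Finset.Icc 1 n ×ˢ Finset.Icc 1 n then y q else 0) = y q := by
        split_ifs with h
        · rfl
        · exact (hz q h).symm
      have e2 : (if q.swap ∈ Finset.Icc 1 n ×ˢ Finset.Icc 1 n then y q.swap else 0) = y q := by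
        split_ifs with h
        · exact hsymm q
        · rw [← hsymm q, hz _ h]
      rw [e1, e2]
      ring
    · simp [Prod.snd_sum, edgeVec]
  rw [← Submodule.smul_mem_iff _ (two_ne_zero (α := ℝ)), h2]
  refine Submodule.sum_mem _ fun p _ => ?_
  by_cases h : y p = 0
  · simp [h]
  · obtain ⟨h1, h2, h3, h4⟩ := hsupp p h
    exact Submodule.smul_mem _ _ (edgeVec_mem_tightSpan hK1 hK2 h1 h2 h3 h4)

theorem labelVec_edge_part_sub_mem {n K : ℕ} (hK1 : 3 ≤ K) (hK2 : K ≤ n - 2) {g h : ℕ → ℕ}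
    (h12 : g 1 = g 2 ↔ h 1 = h 2) (h13 : g 1 = g 3 ↔ h 1 = h 3)
    (h23 : g 2 = g 3 ↔ h 2 = h 3) :
    (((labelVec n g).1 - (labelVec n h).1, 0) : GPoint) ∈ tightSpan n K := by
  refine edge_part_mem_tightSpan hK1 hK2 ?_ ?_
  · rintro ⟨u, v⟩
    have hs : ∀ f : ℕ → ℕ, (labelVec n f).1 (v, u) = (labelVec n f).1 (u, v) := by
      intro f
      exact if_congr (by simp only; tauto) rfl rfl
    simp [hs]
  · rintro ⟨u, v⟩ hne
    by_cases hu : u ∈ Finset.Icc 1 n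
    · by_cases hv : v ∈ Finset.Icc 1 n
      · simp only [Pi.sub_apply, labelVec_fst hu hv] at hne
        refine ⟨hu, hv, ?_, ?_⟩
        · rintro hh
          simp only at hh
          subst hh
          simp at hne
        · by_contra hlt
          simp only [not_or, not_le] at hlt
          apply hne
          have : g u = g v ↔ h u = h v := by
            rw [Finset.mem_Icc] at hu hv
            obtain rfl | rfl | rfl : u = 1 ∨ u = 2 ∨ u = 3 := by omega
            all_goals obtain rfl | rfl | rfl : v = 1 ∨ v = 2 ∨ v = 3 := by omega
            all_goals grind
          simp [this]
      · exact absurd (by simp only [labelVec, Pi.sub_apply, hv]; simp) hne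
    · exact absurd (by simp only [labelVec, Pi.sub_apply, hu]; simp) hne

theorem single_sub_single_mem_tightSpan {n K : ℕ} (hK1 : 3 ≤ K) (hK2 : K ≤ n - 2) {u v : ℕ}
    (hu : u ∈ Finset.Icc 4 n) (hv : v ∈ Finset.Icc 4 n) :
    ((0, Pi.single u 1 - Pi.single v 1) : GPoint) ∈ tightSpan n K := by
  classical
  by_cases huv : u = v
  · subst huv
    rw [sub_self]
    exact zero_mem _
  rw [Finset.mem_Icc] at hu hv
  have m1 : 1 ∈ Finset.Icc 1 n := by rw [Finset.mem_Icc]; omega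
  have m2 : 2 ∈ Finset.Icc 1 n := by rw [Finset.mem_Icc]; omega
  have m3 : 3 ∈ Finset.Icc 1 n := by rw [Finset.mem_Icc]; omega
  have mu : u ∈ Finset.Icc 1 n := by rw [Finset.mem_Icc]; omega
  have mv : v ∈ Finset.Icc 1 n := by rw [Finset.mem_Icc]; omega
  obtain ⟨g, hg, hg2, hgv, hg1, hgu, hgo⟩ := exists_isLabelling hK1 hK2 m2 mv m1 mu
    (by simp; omega)
  have hg3 := (hgo 3 m3 (by omega) (by omega) (by omega) (by omega)).1
  set σ := Equiv.swap u v with hσ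
  have hσne : ∀ w, w ≠ u → w ≠ v → σ w = w := fun w h1 h2 => Equiv.swap_apply_of_ne_of_ne h1 h2
  have hσu : σ u = v := Equiv.swap_apply_left u v
  have hσv : σ v = u := Equiv.swap_apply_right u v
  have hσ1 : σ 1 = 1 := hσne 1 (by omega) (by omega)
  have hσ2 : σ 2 = 2 := hσne 2 (by omega) (by omega)
  have hσ3 : σ 3 = 3 := hσne 3 (by omega) (by omega)
  have hσm : ∀ w, w ∈ Finset.Icc 1 n → σ w ∈ Finset.Icc 1 n := by
    intro w hw
    by_cases h1 : w = u
    · rwa [h1, hσu]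
    by_cases h2 : w = v
    · rwa [h2, hσv]
    rwa [hσne w h1 h2]
  have hσσ : ∀ w, σ (σ w) = w := fun w => Equiv.swap_apply_self u v w
  have hgσ : IsLabelling n K (g ∘ σ) := by
    rw [IsLabelling, ← hg]
    congr 1
    ext k
    simp only [Finset.mem_image, Function.comp]
    constructor
    · rintro ⟨w, hw, rfl⟩
      exact ⟨_, hσm w hw, rfl⟩
    · rintro ⟨w, hw, rfl⟩
      exact ⟨_, hσm w hw, by rw [hσσ]⟩
  have hs : Splits g := fun h => hg3 (by rw [← h.2, hg1])
  have hsσ : Splits (g ∘ σ) := by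
    simpa only [Splits, Function.comp, hσ1, hσ2, hσ3] using hs
  have hE := labelVec_edge_part_sub_mem hK1 hK2 (n := n) (g := g) (h := g ∘ σ)
    (by simp [hσ1, hσ2]) (by simp [hσ1, hσ3]) (by simp [hσ2, hσ3])
  have hD := sub_mem (sub_mem_tightSpan hg hs hgσ hsσ) hE
  have hmu : IsClassMin n g u := by
    intro w hw hwu
    by_contra hlt
    by_cases h1 : w = 1
    · subst h1; omega
    by_cases h2 : w = 2
    · subst h2; omega
    by_cases h3 : w = v
    · subst h3; omega
    exact (hgo w hw h2 h3 h1 (by omega)).2 (by omega)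
  have hmv : ¬ IsClassMin n g v := fun h => by
    have := h 1 m1 (by omega)
    omega
  have hmv' : IsClassMin n (g ∘ σ) v := by
    intro w hw hwv
    simp only [Function.comp, hσv] at hwv
    by_contra hlt
    by_cases h1 : w = 1
    · subst h1; rw [hσ1] at hwv; omega
    by_cases h2 : w = 2
    · subst h2; rw [hσ2] at hwv; omega
    by_cases h3 : w = u
    · subst h3; rw [hσu] at hwv; omega
    rw [hσne w h3 (by omega)] at hwv
    exact (hgo w hw h2 (by omega) h1 (by omega)).2 (by omega)
  have hmu' : ¬ IsClassMin n (g ∘ σ) u := fun h => by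
    have := h 1 m1 (by simp only [Function.comp, hσ1, hσu]; omega)
    omega
  have hmo : ∀ w ∈ Finset.Icc 4 n, w ≠ u → w ≠ v →
      (IsClassMin n g w ↔ IsClassMin n (g ∘ σ) w) := by
    intro w hw hwu hwv
    rw [Finset.mem_Icc] at hw
    have hgw := hgo w (by rw [Finset.mem_Icc]; omega) (by omega) hwv (by omega) hwu
    refine forall₂_congr fun z hz => ?_
    simp only [Function.comp, hσne w hwu hwv]
    by_cases h1 : z = u
    · subst h1; rw [hσu]; omega
    by_cases h2 : z = v
    · subst h2; rw [hσv]; omega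
    rw [hσne z h1 h2]
  convert hD using 1
  refine Prod.ext (funext fun p => ?_) (funext fun w => ?_)
  · simp
  · simp only [Prod.snd_sub, Pi.sub_apply, Pi.zero_apply, sub_zero, Pi.single_apply, labelVec]
    by_cases h1 : w = u
    · subst h1
      simp [hmu, hmu', huv, hu]
    by_cases h2 : w = v
    · subst h2
      simp [hmv, hmv', h1, hv]
    by_cases hw : w ∈ Finset.Icc 4 n
    · simp [h1, h2, hmo w hw h1 h2]
    · simp only [hw]
      simp [h1, h2]

theorem rep_part_mem_tightSpan {n K : ℕ} (hK1 : 3 ≤ K) (hK2 : K ≤ n - 2) {z : ℕ → ℝ}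
    (hsupp : ∀ v ∉ Finset.Icc 4 n, z v = 0) (hsum : ∑ v ∈ Finset.Icc 4 n, z v = 0) :
    ((0, z) : GPoint) ∈ tightSpan n K := by
  have h4 : 4 ∈ Finset.Icc 4 n := by rw [Finset.mem_Icc]; omega
  have hz : ((0, z) : GPoint)
      = ∑ v ∈ Finset.Icc 4 n, z v • ((0, Pi.single v 1 - Pi.single 4 1) : GPoint) := by
    refine Prod.ext (funext fun p => ?_) (funext fun w => ?_)
    · simp [Prod.fst_sum]
    · simp only [Prod.snd_sum, Finset.sum_apply, Prod.smul_snd, Pi.smul_apply, Pi.sub_apply,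
        smul_eq_mul, mul_sub, Finset.sum_sub_distrib, ← Finset.sum_mul, hsum, zero_mul, sub_zero]
      simp only [Pi.single_apply, mul_ite, mul_one, mul_zero, Finset.sum_ite_eq]
      split_ifs with h
      · rfl
      · exact hsupp w h
  rw [hz]
  exact Submodule.sum_mem _ fun v hv =>
    Submodule.smul_mem _ _ (single_sub_single_mem_tightSpan hK1 hK2 hv h4)

theorem sub_mem_tightSpan_of_not_splits {n K : ℕ} (hK1 : 3 ≤ K) (hK2 : K ≤ n - 2)
    {g h : ℕ → ℕ} (hg : IsLabelling n K g) (hgs : ¬ Splits g)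
    (hh : IsLabelling n K h) (hhs : ¬ Splits h) :
    labelVec n g - labelVec n h ∈ tightSpan n K := by
  classical
  rw [Splits, not_not] at hgs hhs
  have hg23 : g 2 = g 3 := hgs.1.symm.trans hgs.2
  have hh23 : h 2 = h 3 := hhs.1.symm.trans hhs.2
  have hE := labelVec_edge_part_sub_mem hK1 hK2 (n := n) (g := g) (h := h)
    (iff_of_true hgs.1 hhs.1) (iff_of_true hgs.2 hhs.2) (iff_of_true hg23 hh23)
  have hR := rep_part_mem_tightSpan hK1 hK2 (z := (labelVec n g).2 - (labelVec n h).2)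
    (fun v hv => by simp only [labelVec, Pi.sub_apply, hv]; simp)
    (by
      simp only [Pi.sub_apply, Finset.sum_sub_distrib,
        sum_labelVec_snd (by omega : 3 ≤ n) hg, sum_labelVec_snd (by omega : 3 ≤ n) hh]
      simp [hgs.1, hhs.1, hg23, hh23])
  convert add_mem hE hR using 1
  simp [Prod.ext_iff]

theorem exists_not_splits {n K : ℕ} (hK1 : 3 ≤ K) (hK2 : K ≤ n - 2) :
    ∃ g, IsLabelling n K g ∧ ¬ Splits g := by
  obtain ⟨g, hg, h2, h3, h1, -⟩ := exists_isLabelling (n := n) hK1 hK2 (a := 2) (b := 3)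
    (c := 1) (d := 4) (by simp; omega) (by simp; omega) (by simp; omega) (by simp; omega)
    (by simp)
  exact ⟨g, hg, not_not.2 ⟨h1.trans h2.symm, h1.trans h3.symm⟩⟩

theorem exists_splits {n K : ℕ} (hK1 : 3 ≤ K) (hK2 : K ≤ n - 2) :
    ∃ g, IsLabelling n K g ∧ Splits g := by
  obtain ⟨g, hg, h2, h3, h1, h4, -⟩ := exists_isLabelling (n := n) hK1 hK2 (a := 3) (b := 4)
    (c := 1) (d := 2) (by simp; omega) (by simp; omega) (by simp; omega) (by simp; omega)
    (by simp)
  exact ⟨g, hg, fun h => by have := h.1; omega⟩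

/-- For `n ≥ 5` and `3 ≤ K ≤ n-2`, the inequality
`x_{1,2} + x_{1,3} + x_{2,3} - Σ_{i=4}^n x_i ≥ 3 - K` (expressing the lower representative
inequality `x_3 + x_{1,3} + x_{2,3} ≥ 1`) is facet-defining for `P_{n,K}`. -/
theorem lower_rep3_facet (n K : ℕ) (hn : 5 ≤ n) (hK1 : 3 ≤ K) (hK2 : K ≤ n - 2) :
    IsFacetGe n K
      (fun x => x.1 (1, 2) + x.1 (1, 3) + x.1 (2, 3) - ∑ i ∈ Finset.Icc 4 n, x.2 i)
      ((3 : ℝ) - (K : ℝ)) := by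
  classical
  have hn3 : 3 ≤ n := by omega
  change (∀ x ∈ PolyP n K, (3 : ℝ) - K ≤ repFunctional n x) ∧
    adim {x | x ∈ PolyP n K ∧ repFunctional n x = (3 : ℝ) - K} + 1 = adim (PolyP n K)
  have hmemP : ∀ g, IsLabelling n K g → labelVec n g ∈ PolyP n K := by
    intro g hg
    rw [PolyP, setOf_charVec_eq]
    exact subset_convexHull ℝ _ ⟨g, hg, rfl⟩
  refine ⟨?_, ?_⟩
  · have hconv : Convex ℝ {x : GPoint | (3 : ℝ) - K ≤ repFunctional n x} :=
      convex_halfSpace_ge (repFunctional n).isLinear _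
    rw [PolyP, setOf_charVec_eq]
    refine fun x hx => convexHull_min ?_ hconv hx
    rintro _ ⟨g, hg, rfl⟩
    rw [Set.mem_ofPred_eq, repFunctional_labelVec hn3 hg]
    split_ifs <;> linarith
  · set F := {x | x ∈ PolyP n K ∧ repFunctional n x = (3 : ℝ) - K}
    obtain ⟨g₁, hg₁, hs₁⟩ := exists_not_splits (n := n) hK1 hK2
    obtain ⟨g₀, hg₀, hs₀⟩ := exists_splits (n := n) hK1 hK2
    have hFP : vectorSpan ℝ F ≤ vectorSpan ℝ (PolyP n K) :=
      vectorSpan_mono ℝ fun x hx => hx.1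
    have hTF : tightSpan n K ≤ vectorSpan ℝ F := by
      refine vectorSpan_mono ℝ ?_
      rintro _ ⟨g, hg, hs, rfl⟩
      exact ⟨hmemP g hg, by rw [repFunctional_labelVec hn3 hg, if_pos hs]⟩
    have hker : vectorSpan ℝ F ≤ LinearMap.ker (repFunctional n) := by
      rw [vectorSpan_def, Submodule.span_le]
      rintro _ ⟨x, hx, y, hy, rfl⟩
      simp [hx.2, hy.2]
    have hPX : vectorSpan ℝ (PolyP n K)
        = vectorSpan ℝ {x | ∃ g, IsLabelling n K g ∧ x = labelVec n g} := by
      rw [PolyP, setOf_charVec_eq, ← direction_affineSpan, affineSpan_convexHull,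
        direction_affineSpan]
    have hfin : FiniteDimensional ℝ (vectorSpan ℝ (PolyP n K)) := by
      rw [hPX, ← setOf_charVec_eq]
      refine finiteDimensional_vectorSpan_of_finite ℝ ?_
      refine (Set.finite_range (charVec n K)).subset ?_
      rintro _ ⟨π, rfl⟩
      exact ⟨π, rfl⟩
    have hfinF : FiniteDimensional ℝ (vectorSpan ℝ F) :=
      Submodule.finiteDimensional_of_le hFP
    have hd : labelVec n g₁ - labelVec n g₀ ∉ vectorSpan ℝ F := by
      intro h
      have := hker h
      rw [LinearMap.mem_ker, map_sub, repFunctional_labelVec hn3 hg₁,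
        repFunctional_labelVec hn3 hg₀, if_neg hs₁, if_pos hs₀] at this
      linarith
    have hsup : vectorSpan ℝ (PolyP n K)
        = vectorSpan ℝ F ⊔ Submodule.span ℝ {labelVec n g₁ - labelVec n g₀} := by
      refine le_antisymm ?_ (sup_le hFP ?_)
      · rw [hPX, vectorSpan_eq_span_vsub_set_right ℝ
          (show labelVec n g₀ ∈ {x | ∃ g, IsLabelling n K g ∧ x = labelVec n g} from
            ⟨g₀, hg₀, rfl⟩), Submodule.span_le]
        rintro _ ⟨_, ⟨g, hg, rfl⟩, rfl⟩
        by_cases hs : Splits g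
        · exact Submodule.mem_sup_left (hTF (sub_mem_tightSpan hg hs hg₀ hs₀))
        · rw [SetLike.mem_coe]
          dsimp only
          rw [vsub_eq_sub, ← sub_add_sub_cancel (labelVec n g) (labelVec n g₁) (labelVec n g₀)]
          exact add_mem (Submodule.mem_sup_left
              (hTF (sub_mem_tightSpan_of_not_splits hK1 hK2 hg hs hg₁ hs₁)))
            (Submodule.mem_sup_right (Submodule.mem_span_singleton_self _))
      · rw [Submodule.span_singleton_le_iff_mem]
        exact vsub_mem_vectorSpan ℝ (hmemP g₁ hg₁) (hmemP g₀ hg₀)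
    rw [adim, adim, direction_affineSpan, direction_affineSpan, hsup]
    have hd0 : labelVec n g₁ - labelVec n g₀ ≠ 0 := fun h => hd (h ▸ zero_mem _)
    have hinf : vectorSpan ℝ F ⊓ Submodule.span ℝ {labelVec n g₁ - labelVec n g₀} = ⊥ :=
      ((Submodule.disjoint_span_singleton' hd0).2 hd).eq_bot
    have h := Submodule.finrank_sup_add_finrank_inf_eq (vectorSpan ℝ F)
      (Submodule.span ℝ {labelVec n g₁ - labelVec n g₀})
    rw [hinf, finrank_bot, add_zero, finrank_span_singleton hd0] at h
    exact h.symm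
end
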